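/- Let Y ~ ST_d(ξ, Ω, α, ν) with ν > 0 and α* = (αᵀΩ̄α)^{1/2} and define w(y) = α* y ((ν+d)/(ν+y²))^{1/2}. Then the equation y(ν+d)^{1/2} T₁(w(y); ν+d) − t₁(w(y); ν+d) ν α* (ν+y²)^{−1/2} = 0 has a unique real solution y₀*, y₀* ≥ 0, and the density of Y has a unique mode given by M₀ = ξ + (y₀*/α*) ω Ω̄ α = ξ + (y₀*/δ*) ω δ, where δ = Ω̄α/(1+αᵀΩ̄α)^{1/2} and δ* = (δᵀΩ̄⁻¹δ)^{1/2}. (When α = 0 the mode is M₀ = ξ.) -/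

import Mathlib

open MeasureTheory ProbabilityTheory Matrix

noncomputable section

/-- Standard normal density. -/
def stdNormalPDF (x : ℝ) : ℝ := (Real.sqrt (2 * Real.pi))⁻¹ * Real.exp (-x ^ 2 / 2)

/-- Standard normal cumulative distribution function `Φ`. -/
def stdNormalCDF (x : ℝ) : ℝ := ∫ t in Set.Iic x, stdNormalPDF t

/-- Density `φ_d(x; Ω)` of the centered multivariate normal `N_d(0, Ω)`. -/
def mvnPDF {d : ℕ} (Ωm : Matrix (Fin d) (Fin d) ℝ) (x : Fin d → ℝ) : ℝ :=
  (2 * Real.pi) ^ (-(d : ℝ) / 2) * Ωm.det ^ (-(1 : ℝ) / 2) *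
    Real.exp (-(x ⬝ᵥ (Ωm⁻¹ *ᵥ x)) / 2)

/-- The diagonal matrix `ω` of scale parameters, `ω_ii = √(Ω_ii)`. -/
def scaleMat {d : ℕ} (Ωm : Matrix (Fin d) (Fin d) ℝ) : Matrix (Fin d) (Fin d) ℝ :=
  Matrix.diagonal fun i => Real.sqrt (Ωm i i)

/-- The correlation matrix `Ω̄ = ω⁻¹ Ω ω⁻¹`. -/
def corrMat {d : ℕ} (Ωm : Matrix (Fin d) (Fin d) ℝ) : Matrix (Fin d) (Fin d) ℝ :=
  (scaleMat Ωm)⁻¹ * Ωm * (scaleMat Ωm)⁻¹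

/-- Density of the multivariate skew-normal distribution `SN_d(ξ, Ω, α)`. -/
def snPDF {d : ℕ} (ξ : Fin d → ℝ) (Ωm : Matrix (Fin d) (Fin d) ℝ) (α : Fin d → ℝ)
    (z : Fin d → ℝ) : ℝ :=
  2 * mvnPDF Ωm (z - ξ) * stdNormalCDF (α ⬝ᵥ ((scaleMat Ωm)⁻¹ *ᵥ (z - ξ)))

/-- `Z ~ SN_d(ξ, Ω, α)`. -/
def IsSN {Ω' : Type*} [MeasurableSpace Ω'] (P : Measure Ω') {d : ℕ}
    (Z : Ω' → Fin d → ℝ) (ξ : Fin d → ℝ) (Ωm : Matrix (Fin d) (Fin d) ℝ)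
    (α : Fin d → ℝ) : Prop :=
  Measure.map Z P = volume.withDensity fun z => ENNReal.ofReal (snPDF ξ Ωm α z)

/-- Density of the univariate skew-normal distribution `SN₁(0,1,α)`. -/
def sn1PDF (α x : ℝ) : ℝ := 2 * stdNormalPDF x * stdNormalCDF (α * x)

/-- The vector `δ = Ω̄α / (1 + αᵀΩ̄α)^{1/2}`. -/
def deltaOf {d : ℕ} (Ωb : Matrix (Fin d) (Fin d) ℝ) (α : Fin d → ℝ) : Fin d → ℝ :=
  (Real.sqrt (1 + α ⬝ᵥ (Ωb *ᵥ α)))⁻¹ • (Ωb *ᵥ α)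

/-- Density of the univariate Student `t` distribution with `m` degrees of freedom. -/
def t1PDF (m x : ℝ) : ℝ :=
  Real.Gamma ((m + 1) / 2) / (Real.Gamma (m / 2) * Real.sqrt (m * Real.pi)) *
    (1 + x ^ 2 / m) ^ (-(m + 1) / 2)

/-- Cumulative distribution function `T₁(·; m)` of the univariate Student `t`
distribution with `m` degrees of freedom. -/
def T1CDF (m x : ℝ) : ℝ := ∫ t in Set.Iic x, t1PDF m t

/-- Density of the centered `d`-dimensional Student `t` distribution with scale matrix
`Ω` and `ν` degrees of freedom. -/
def tdPDF {d : ℕ} (Ωm : Matrix (Fin d) (Fin d) ℝ) (ν : ℝ) (x : Fin d → ℝ) : ℝ :=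
  Real.Gamma ((ν + d) / 2) /
      (Real.Gamma (ν / 2) * (ν * Real.pi) ^ ((d : ℝ) / 2) * Real.sqrt Ωm.det) *
    (1 + (x ⬝ᵥ (Ωm⁻¹ *ᵥ x)) / ν) ^ (-(ν + d) / 2)

/-- Density of the multivariate skew `t` distribution `ST_d(ξ, Ω, α, ν)`. -/
def stPDF {d : ℕ} (ξ : Fin d → ℝ) (Ωm : Matrix (Fin d) (Fin d) ℝ) (α : Fin d → ℝ)
    (ν : ℝ) (y : Fin d → ℝ) : ℝ :=
  2 * tdPDF Ωm ν (y - ξ) *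
    T1CDF (ν + d) ((α ⬝ᵥ ((scaleMat Ωm)⁻¹ *ᵥ (y - ξ))) *
      Real.sqrt ((ν + d) / ((y - ξ) ⬝ᵥ (Ωm⁻¹ *ᵥ (y - ξ)) + ν)))

/-- `Y ~ ST_d(ξ, Ω, α, ν)`. -/
def IsST {Ω' : Type*} [MeasurableSpace Ω'] (P : MeasureTheory.Measure Ω') {d : ℕ}
    (Y : Ω' → Fin d → ℝ) (ξ : Fin d → ℝ) (Ωm : Matrix (Fin d) (Fin d) ℝ)
    (α : Fin d → ℝ) (ν : ℝ) : Prop :=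
  Measure.map Y P = volume.withDensity fun y => ENNReal.ofReal (stPDF ξ Ωm α ν y)

/-- Density of the univariate skew `t` distribution `ST₁(0, 1, α, ν)`. -/
def st1PDF (α ν x : ℝ) : ℝ :=
  2 * t1PDF ν x * T1CDF (ν + 1) (α * x * Real.sqrt ((ν + 1) / (x ^ 2 + ν)))

theorem t1PDF_pos {m : ℝ} (hm : 0 < m) (x : ℝ) : 0 < t1PDF m x := by
  have h1 : 0 < Real.Gamma ((m + 1) / 2) := Real.Gamma_pos_of_pos (by positivity)
  have h2 : 0 < Real.Gamma (m / 2) := Real.Gamma_pos_of_pos (by positivity)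
  unfold t1PDF
  positivity

theorem continuous_t1PDF {m : ℝ} (hm : 0 < m) : Continuous (t1PDF m) := by
  unfold t1PDF
  refine continuous_const.mul (Continuous.rpow_const (by fun_prop) fun x => Or.inl ?_)
  positivity

theorem integrable_t1PDF {m : ℝ} (hm : 0 < m) : Integrable (t1PDF m) := by
  have h := integrable_rpow_neg_one_add_norm_sq (E := ℝ) (μ := volume) (r := m + 1) (by simpa)
  have h2 := (h.comp_div (Real.sqrt_pos.2 hm).ne').const_mul
    (Real.Gamma ((m + 1) / 2) / (Real.Gamma (m / 2) * Real.sqrt (m * Real.pi)))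
  refine h2.congr (Filter.Eventually.of_forall fun x => ?_)
  simp only [t1PDF, norm_div, div_pow, Real.norm_eq_abs, sq_abs, Real.sq_sqrt hm.le]

theorem t1PDF_anti {m x y : ℝ} (hm : 0 < m) (hx : 0 ≤ x) (hxy : x ≤ y) :
    t1PDF m y ≤ t1PDF m x := by
  have h1 : 0 < Real.Gamma ((m + 1) / 2) := Real.Gamma_pos_of_pos (by positivity)
  have h2 : 0 < Real.Gamma (m / 2) := Real.Gamma_pos_of_pos (by positivity)
  unfold t1PDF
  refine mul_le_mul_of_nonneg_left ?_ (by positivity)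
  refine Real.rpow_le_rpow_of_nonpos (by positivity) ?_ (by linarith)
  gcongr

theorem hasDerivAt_T1CDF {m : ℝ} (hm : 0 < m) (x : ℝ) :
    HasDerivAt (T1CDF m) (t1PDF m x) x := by
  have hi := integrable_t1PDF hm
  have hc := continuous_t1PDF hm
  have h : T1CDF m = fun y => T1CDF m 0 + ∫ t in (0 : ℝ)..y, t1PDF m t := by
    funext y
    rw [← intervalIntegral.integral_Iic_sub_Iic hi.integrableOn hi.integrableOn]
    simp [T1CDF]
  rw [h]
  exact (intervalIntegral.integral_hasDerivAt_right (hc.intervalIntegrable _ _)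
    (hc.stronglyMeasurableAtFilter _ _) hc.continuousAt).const_add _

theorem T1CDF_strictMono {m : ℝ} (hm : 0 < m) : StrictMono (T1CDF m) :=
  strictMono_of_hasDerivAt_pos (hasDerivAt_T1CDF hm) (t1PDF_pos hm)

theorem continuous_T1CDF {m : ℝ} (hm : 0 < m) : Continuous (T1CDF m) :=
  continuous_iff_continuousAt.2 fun x => (hasDerivAt_T1CDF hm x).continuousAt

theorem T1CDF_pos {m : ℝ} (hm : 0 < m) (x : ℝ) : 0 < T1CDF m x :=
  (setIntegral_nonneg measurableSet_Iic fun t _ => (t1PDF_pos hm t).le).trans_lt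
    (T1CDF_strictMono hm (sub_one_lt x))

/-- The argument of the skewing factor along the ray of maximal skewness. -/
def skewArg (m ν A y : ℝ) : ℝ := A * y * Real.sqrt (m / (ν + y ^ 2))

/-- The left-hand side of the mode equation. -/
def modeEq (m ν A y : ℝ) : ℝ :=
  y * Real.sqrt m * T1CDF m (skewArg m ν A y) -
    t1PDF m (skewArg m ν A y) * ν * A * (Real.sqrt (ν + y ^ 2))⁻¹

/-- The skew `t` density along the ray of maximal skewness, up to a constant. -/
def skewProfile (m ν A y : ℝ) : ℝ :=
  (1 + y ^ 2 / ν) ^ (-m / 2) * T1CDF m (skewArg m ν A y)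

section profile

variable {m ν A : ℝ}

theorem skewArg_eq (hm : 0 < m) (y : ℝ) :
    skewArg m ν A y = A * Real.sqrt m * (y / Real.sqrt (ν + y ^ 2)) := by
  rw [skewArg, Real.sqrt_div hm.le]; ring

theorem hasDerivAt_skewArg (hm : 0 < m) (hν : 0 < ν) (y : ℝ) :
    HasDerivAt (skewArg m ν A)
      (A * Real.sqrt m * (ν / (Real.sqrt (ν + y ^ 2)) ^ 3)) y := by
  have hp : 0 < ν + y ^ 2 := by positivity
  have hs := Real.sqrt_pos.2 hp
  have h1 : HasDerivAt (fun y : ℝ => ν + y ^ 2) (2 * y) y := by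
    simpa using (hasDerivAt_pow 2 y).const_add ν
  have h2 := (((hasDerivAt_id y).div (h1.sqrt hp.ne') hs.ne').const_mul (A * Real.sqrt m))
  have h3 : skewArg m ν A = fun y => A * Real.sqrt m * (y / Real.sqrt (ν + y ^ 2)) :=
    funext (skewArg_eq hm)
  rw [h3]
  refine h2.congr_deriv ?_
  simp only [id]
  have hsq := Real.sq_sqrt hp.le
  field_simp
  rw [hsq]
  ring

theorem continuous_skewArg (hm : 0 < m) (hν : 0 < ν) : Continuous (skewArg m ν A) :=
  continuous_iff_continuousAt.2 fun y => (hasDerivAt_skewArg hm hν y).continuousAt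

theorem skewArg_strictMono (hm : 0 < m) (hν : 0 < ν) (hA : 0 < A) :
    StrictMono (skewArg m ν A) :=
  strictMono_of_hasDerivAt_pos (hasDerivAt_skewArg hm hν) fun y => by positivity

theorem skewArg_zero : skewArg m ν A 0 = 0 := by simp [skewArg]

theorem hasDerivAt_skewProfile (hm : 0 < m) (hν : 0 < ν) (y : ℝ) :
    HasDerivAt (skewProfile m ν A)
      (-((1 + y ^ 2 / ν) ^ (-m / 2) * (Real.sqrt m / (ν + y ^ 2)) * modeEq m ν A y)) y := by
  have hp : 0 < ν + y ^ 2 := by positivity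
  have hs := Real.sqrt_pos.2 hp
  have hb : 0 < 1 + y ^ 2 / ν := by positivity
  have h1 : HasDerivAt (fun y : ℝ => 1 + y ^ 2 / ν) (2 * y / ν) y := by
    simpa using ((hasDerivAt_pow 2 y).div_const ν).const_add 1
  have h2 := (h1.rpow_const (p := -m / 2) (Or.inl hb.ne')).mul
    ((hasDerivAt_T1CDF hm (skewArg m ν A y)).comp y (hasDerivAt_skewArg hm hν y))
  refine h2.congr_deriv ?_
  rw [Real.rpow_sub_one hb.ne', modeEq]
  have hsq := Real.sq_sqrt hp.le
  have hmq := Real.sq_sqrt hm.le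
  set s := Real.sqrt (ν + y ^ 2)
  set q := Real.sqrt m
  have e : 1 + y ^ 2 / ν = s ^ 2 / ν := by rw [hsq]; field_simp
  rw [← hsq]
  simp only [Function.comp]
  generalize T1CDF m (skewArg m ν A y) = T
  generalize t1PDF m (skewArg m ν A y) = t
  generalize (1 + y ^ 2 / ν) ^ (-m / 2) = R
  rw [e, ← hmq]
  field_simp
  ring

theorem modeEq_neg_of_nonpos (hm : 0 < m) (hν : 0 < ν) (hA : 0 < A) {y : ℝ} (hy : y ≤ 0) :
    modeEq m ν A y < 0 := by
  have h1 : y * Real.sqrt m * T1CDF m (skewArg m ν A y) ≤ 0 :=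
    mul_nonpos_of_nonpos_of_nonneg
      (mul_nonpos_of_nonpos_of_nonneg hy (Real.sqrt_nonneg _)) (T1CDF_pos hm _).le
  have ht := t1PDF_pos hm (skewArg m ν A y)
  have h2 : 0 < t1PDF m (skewArg m ν A y) * ν * A * (Real.sqrt (ν + y ^ 2))⁻¹ := by positivity
  unfold modeEq
  linarith

theorem modeEq_strictMonoOn (hm : 0 < m) (hν : 0 < ν) (hA : 0 < A) :
    StrictMonoOn (modeEq m ν A) (Set.Ici 0) := by
  intro x hx y _ hxy
  have hx : 0 ≤ x := hx
  have hw := skewArg_strictMono hm hν hA hxy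
  have hw0 : 0 ≤ skewArg m ν A x := by unfold skewArg; positivity
  have hT := T1CDF_strictMono hm hw
  have hTx := T1CDF_pos hm (skewArg m ν A x)
  have ht := t1PDF_anti hm hw0 hw.le
  have htx := t1PDF_pos hm (skewArg m ν A x)
  have hty := t1PDF_pos hm (skewArg m ν A y)
  have h1 : x * Real.sqrt m * T1CDF m (skewArg m ν A x) <
      y * Real.sqrt m * T1CDF m (skewArg m ν A y) := by
    have := Real.sqrt_pos.2 hm
    have hy : 0 < y := hx.trans_lt hxy
    gcongr
  have h2 : t1PDF m (skewArg m ν A y) * ν * A * (Real.sqrt (ν + y ^ 2))⁻¹ ≤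
      t1PDF m (skewArg m ν A x) * ν * A * (Real.sqrt (ν + x ^ 2))⁻¹ := by
    gcongr
  unfold modeEq
  linarith

theorem continuous_modeEq (hm : 0 < m) (hν : 0 < ν) : Continuous (modeEq m ν A) := by
  have h1 := continuous_skewArg (A := A) hm hν
  have h2 := (continuous_T1CDF hm).comp h1
  have h3 := (continuous_t1PDF hm).comp h1
  have h4 : Continuous fun y : ℝ => (Real.sqrt (ν + y ^ 2))⁻¹ :=
    Continuous.inv₀ (by fun_prop) fun y => by positivity
  exact ((continuous_id.mul continuous_const).mul h2).sub
    (((h3.mul continuous_const).mul continuous_const).mul h4)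

theorem exists_modeEq_eq_zero (hm : 0 < m) (hν : 0 < ν) (hA : 0 < A) :
    ∃ y, 0 < y ∧ modeEq m ν A y = 0 := by
  have hT0 := T1CDF_pos hm 0
  have ht0 := t1PDF_pos hm 0
  have hq := Real.sqrt_pos.2 hm
  set K := t1PDF m 0 * ν * A * (Real.sqrt ν)⁻¹ with hK
  have hK0 : 0 < K := by positivity
  set B := K / (Real.sqrt m * T1CDF m 0) with hB
  have hB0 : 0 < B := by positivity
  have hw : 0 ≤ skewArg m ν A B := by unfold skewArg; positivity
  have hpos : 0 ≤ modeEq m ν A B := by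
    have h1 : K ≤ B * Real.sqrt m * T1CDF m (skewArg m ν A B) := by
      have : K = B * Real.sqrt m * T1CDF m 0 := by rw [hB]; field_simp
      rw [this]
      have := (T1CDF_strictMono hm).monotone hw
      gcongr
    have h2 : t1PDF m (skewArg m ν A B) * ν * A * (Real.sqrt (ν + B ^ 2))⁻¹ ≤ K := by
      have := t1PDF_anti hm le_rfl hw
      have h3 : ν ≤ ν + B ^ 2 := by linarith [sq_nonneg B]
      rw [hK]
      gcongr
    unfold modeEq
    linarith
  obtain ⟨y, hy, h0⟩ := intermediate_value_Icc hB0.le (continuous_modeEq hm hν).continuousOn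
    ⟨(modeEq_neg_of_nonpos hm hν hA le_rfl).le, hpos⟩
  refine ⟨y, lt_of_not_ge fun h => ?_, h0⟩
  exact (modeEq_neg_of_nonpos hm hν hA h).ne h0

theorem modeEq_neg_of_lt (hm : 0 < m) (hν : 0 < ν) (hA : 0 < A) {y z : ℝ} (hz : 0 < z)
    (h0 : modeEq m ν A z = 0) (hy : y < z) : modeEq m ν A y < 0 := by
  rcases le_total y 0 with h | h
  · exact modeEq_neg_of_nonpos hm hν hA h
  · exact h0 ▸ modeEq_strictMonoOn hm hν hA h hz.le hy

theorem modeEq_pos_of_gt (hm : 0 < m) (hν : 0 < ν) (hA : 0 < A) {y z : ℝ} (hz : 0 < z)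
    (h0 : modeEq m ν A z = 0) (hy : z < y) : 0 < modeEq m ν A y :=
  h0 ▸ modeEq_strictMonoOn hm hν hA hz.le (hz.trans hy).le hy

theorem skewProfile_lt (hm : 0 < m) (hν : 0 < ν) (hA : 0 < A) {y z : ℝ} (hz : 0 < z)
    (h0 : modeEq m ν A z = 0) (hy : y ≠ z) : skewProfile m ν A y < skewProfile m ν A z := by
  have hc : Continuous (skewProfile m ν A) :=
    continuous_iff_continuousAt.2 fun x => (hasDerivAt_skewProfile hm hν x).continuousAt
  rcases lt_or_gt_of_ne hy with h | h
  · refine strictMonoOn_of_deriv_pos (convex_Iic z) hc.continuousOn (fun x hx => ?_)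
      h.le (le_refl z) h
    rw [interior_Iic] at hx
    rw [(hasDerivAt_skewProfile hm hν x).deriv]
    have hn := neg_pos.2 (modeEq_neg_of_lt hm hν hA hz h0 hx)
    rw [← mul_neg]
    positivity
  · refine strictAntiOn_of_deriv_neg (convex_Ici z) hc.continuousOn (fun x hx => ?_)
      (le_refl z) h.le h
    rw [interior_Ici] at hx
    rw [(hasDerivAt_skewProfile hm hν x).deriv]
    have hn := modeEq_pos_of_gt hm hν hA hz h0 hx
    rw [neg_lt_zero]
    positivity

/-- Moving orthogonally to the direction of maximal skewness by squared distance `r`, the density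
stays below its value at the zero of the mode equation. -/
theorem skew_kernel_lt (hm : 0 < m) (hν : 0 < ν) (hA : 0 < A) {y r z : ℝ} (hz : 0 < z)
    (h0 : modeEq m ν A z = 0) (hr : 0 ≤ r) (h : y ≠ z ∨ r ≠ 0) :
    (1 + (y ^ 2 + r) / ν) ^ (-m / 2) * T1CDF m (A * y * Real.sqrt (m / (y ^ 2 + r + ν))) <
      skewProfile m ν A z := by
  have hT := T1CDF_pos hm (A * y * Real.sqrt (m / (y ^ 2 + r + ν)))
  rcases le_or_gt y 0 with hy | hy
  · refine lt_of_le_of_lt ?_ (skewProfile_lt hm hν hA hz h0 hz.ne)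
    rw [skewProfile, skewArg_zero]
    have h1 : A * y * Real.sqrt (m / (y ^ 2 + r + ν)) ≤ 0 :=
      mul_nonpos_of_nonpos_of_nonneg (mul_nonpos_of_nonneg_of_nonpos hA.le hy)
        (Real.sqrt_nonneg _)
    refine mul_le_mul ?_ ((T1CDF_strictMono hm).monotone h1) hT.le (by positivity)
    refine Real.rpow_le_rpow_of_nonpos (by positivity) ?_ (by linarith)
    gcongr
    simpa using by positivity
  rcases hr.eq_or_lt with rfl | hr
  · have := skewProfile_lt hm hν hA hz h0 (by simpa using h)
    simpa [skewProfile, skewArg, add_comm] using this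
  · refine lt_of_lt_of_le (b := skewProfile m ν A y) ?_ ?_
    · rw [skewProfile, skewArg]
      refine mul_lt_mul ?_ ((T1CDF_strictMono hm).monotone ?_) hT (by positivity)
      · refine Real.rpow_lt_rpow_of_neg (by positivity) ?_ (by linarith)
        gcongr
        linarith
      · have h1 : ν + y ^ 2 ≤ y ^ 2 + r + ν := by linarith
        gcongr
    · rcases eq_or_ne y z with rfl | hyz
      · exact le_rfl
      · exact (skewProfile_lt hm hν hA hz h0 hyz).le

end profile

section linear

variable {d : ℕ} {Ωm : Matrix (Fin d) (Fin d) ℝ}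

theorem isUnit_det_scaleMat (hΩ : Ωm.PosDef) : IsUnit (scaleMat Ωm).det := by
  rw [scaleMat, det_diagonal, isUnit_iff_ne_zero]
  exact Finset.prod_ne_zero_iff.2 fun i _ => (Real.sqrt_pos.2 hΩ.diag_pos).ne'

theorem transpose_inv_scaleMat : (scaleMat Ωm)⁻¹ᵀ = (scaleMat Ωm)⁻¹ := by
  rw [transpose_nonsing_inv, scaleMat, diagonal_transpose]

theorem isUnit_det_corrMat (hΩ : Ωm.PosDef) : IsUnit (corrMat Ωm).det := by
  have h := (isUnit_nonsing_inv_det_iff (A := scaleMat Ωm)).2 (isUnit_det_scaleMat hΩ)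
  rw [corrMat, det_mul, det_mul]
  exact (h.mul hΩ.det_pos.ne'.isUnit).mul h

theorem scaleMat_mulVec_corrMat (hΩ : Ωm.PosDef) (α : Fin d → ℝ) :
    scaleMat Ωm *ᵥ (corrMat Ωm *ᵥ α) = Ωm *ᵥ ((scaleMat Ωm)⁻¹ *ᵥ α) := by
  rw [mulVec_mulVec, mulVec_mulVec, corrMat, ← Matrix.mul_assoc, ← Matrix.mul_assoc,
    mul_nonsing_inv _ (isUnit_det_scaleMat hΩ), Matrix.one_mul]

theorem dotProduct_inv_scaleMat_mulVec (α z : Fin d → ℝ) :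
    α ⬝ᵥ ((scaleMat Ωm)⁻¹ *ᵥ z) = ((scaleMat Ωm)⁻¹ *ᵥ α) ⬝ᵥ z := by
  rw [dotProduct_mulVec, ← mulVec_transpose, transpose_inv_scaleMat]

theorem dotProduct_corrMat_mulVec (α : Fin d → ℝ) :
    α ⬝ᵥ (corrMat Ωm *ᵥ α) =
      ((scaleMat Ωm)⁻¹ *ᵥ α) ⬝ᵥ (Ωm *ᵥ ((scaleMat Ωm)⁻¹ *ᵥ α)) := by
  rw [corrMat, ← mulVec_mulVec, ← mulVec_mulVec, dotProduct_inv_scaleMat_mulVec]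

theorem inv_scaleMat_mulVec_ne_zero (hΩ : Ωm.PosDef) {α : Fin d → ℝ} (hα : α ≠ 0) :
    (scaleMat Ωm)⁻¹ *ᵥ α ≠ 0 := by
  intro h
  apply hα
  have := congrArg (scaleMat Ωm *ᵥ ·) h
  simpa [mulVec_mulVec, mul_nonsing_inv _ (isUnit_det_scaleMat hΩ)] using this

theorem dotProduct_corrMat_mulVec_pos (hΩ : Ωm.PosDef) {α : Fin d → ℝ} (hα : α ≠ 0) :
    0 < α ⬝ᵥ (corrMat Ωm *ᵥ α) := by
  rw [dotProduct_corrMat_mulVec]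
  simpa using hΩ.dotProduct_mulVec_pos (inv_scaleMat_mulVec_ne_zero hΩ hα)

/-- Pythagoras for the form `Ω⁻¹`, splitting off the component of `v` along `Ω b`. -/
theorem quadForm_inv_add_smul (hΩ : Ωm.PosDef) (b v : Fin d → ℝ) (c : ℝ) :
    (v + c • (Ωm *ᵥ b)) ⬝ᵥ (Ωm⁻¹ *ᵥ (v + c • (Ωm *ᵥ b))) =
      v ⬝ᵥ (Ωm⁻¹ *ᵥ v) + 2 * c * (b ⬝ᵥ v) + c ^ 2 * (b ⬝ᵥ (Ωm *ᵥ b)) := by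
  have hu : IsUnit Ωm.det := hΩ.det_pos.ne'.isUnit
  have e : Ωm⁻¹ *ᵥ (Ωm *ᵥ b) = b := by
    rw [mulVec_mulVec, nonsing_inv_mul _ hu, one_mulVec]
  have ht : Ωm⁻¹ᵀ = Ωm⁻¹ := by simpa using hΩ.inv.isHermitian.eq
  have e2 : (Ωm *ᵥ b) ⬝ᵥ (Ωm⁻¹ *ᵥ v) = b ⬝ᵥ v := by
    rw [dotProduct_mulVec, ← mulVec_transpose, ht, e]
  simp only [mulVec_add, mulVec_smul, e, add_dotProduct, dotProduct_add, smul_dotProduct,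
    dotProduct_smul, smul_eq_mul, e2, dotProduct_comm v b, dotProduct_comm (Ωm *ᵥ b) b]
  ring

end linear

/-- The skew `t` density without its normalising constant. -/
def skewKernel {d : ℕ} (Ωm : Matrix (Fin d) (Fin d) ℝ) (α : Fin d → ℝ) (ν : ℝ)
    (z : Fin d → ℝ) : ℝ :=
  (1 + (z ⬝ᵥ (Ωm⁻¹ *ᵥ z)) / ν) ^ (-(ν + d) / 2) *
    T1CDF (ν + d) ((α ⬝ᵥ ((scaleMat Ωm)⁻¹ *ᵥ z)) *
      Real.sqrt ((ν + d) / (z ⬝ᵥ (Ωm⁻¹ *ᵥ z) + ν)))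

theorem stPDF_lt_of_skewKernel_lt {d : ℕ} {Ωm : Matrix (Fin d) (Fin d) ℝ} (hΩ : Ωm.PosDef)
    {ν : ℝ} (hν : 0 < ν) (ξ α : Fin d → ℝ) {x y : Fin d → ℝ}
    (h : skewKernel Ωm α ν (x - ξ) < skewKernel Ωm α ν (y - ξ)) :
    stPDF ξ Ωm α ν x < stPDF ξ Ωm α ν y := by
  have h1 : 0 < Real.Gamma ((ν + d) / 2) := Real.Gamma_pos_of_pos (by positivity)
  have h2 : 0 < Real.Gamma (ν / 2) := Real.Gamma_pos_of_pos (by positivity)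
  have h3 := Real.sqrt_pos.2 hΩ.det_pos
  have hC : 0 < 2 * (Real.Gamma ((ν + d) / 2) /
      (Real.Gamma (ν / 2) * (ν * Real.pi) ^ ((d : ℝ) / 2) * Real.sqrt Ωm.det)) := by positivity
  have := mul_lt_mul_of_pos_left h hC
  simpa only [stPDF, tdPDF, skewKernel, mul_assoc] using this

theorem skewKernel_lt_skewProfile {d : ℕ} {Ωm : Matrix (Fin d) (Fin d) ℝ} (hΩ : Ωm.PosDef)
    {ν : ℝ} (hν : 0 < ν) {α : Fin d → ℝ} (hα : α ≠ 0) {A y0 : ℝ}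
    (hA : A = Real.sqrt (α ⬝ᵥ (corrMat Ωm *ᵥ α))) (hy0 : 0 < y0)
    (h0 : modeEq (ν + d) ν A y0 = 0) {z : Fin d → ℝ}
    (hz : z ≠ (y0 / A) • (Ωm *ᵥ ((scaleMat Ωm)⁻¹ *ᵥ α))) :
    skewKernel Ωm α ν z < skewProfile (ν + d) ν A y0 := by
  have hp := dotProduct_corrMat_mulVec_pos hΩ hα
  have hA0 : 0 < A := hA ▸ Real.sqrt_pos.2 hp
  have hA2 : A ^ 2 = α ⬝ᵥ (corrMat Ωm *ᵥ α) := hA ▸ Real.sq_sqrt hp.le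
  rw [dotProduct_corrMat_mulVec] at hA2
  have hm : 0 < ν + d := by positivity
  rw [skewKernel, dotProduct_inv_scaleMat_mulVec]
  set b := (scaleMat Ωm)⁻¹ *ᵥ α
  set u := (b ⬝ᵥ z) / A with hu
  set v := z - (u / A) • (Ωm *ᵥ b) with hv
  have hbz : b ⬝ᵥ z = A * u := by rw [hu]; field_simp
  have hbv : b ⬝ᵥ v = 0 := by
    rw [hv, dotProduct_sub, dotProduct_smul, smul_eq_mul, ← hA2, hbz]
    field_simp
    ring
  have hzv : z = v + (u / A) • (Ωm *ᵥ b) := by rw [hv]; abel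
  have hQ : z ⬝ᵥ (Ωm⁻¹ *ᵥ z) = u ^ 2 + v ⬝ᵥ (Ωm⁻¹ *ᵥ v) := by
    conv_lhs => rw [hzv]
    rw [quadForm_inv_add_smul hΩ, hbv, ← hA2]
    field_simp
    ring
  have hr : 0 ≤ v ⬝ᵥ (Ωm⁻¹ *ᵥ v) := by
    simpa using hΩ.inv.posSemidef.dotProduct_mulVec_nonneg v
  rw [hQ, hbz]
  refine skew_kernel_lt hm hν hA0 hy0 h0 hr ?_
  by_contra! hcon
  have hv0 : v = 0 := by
    by_contra hne
    have := hΩ.inv.dotProduct_mulVec_pos hne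
    simp [hcon.2] at this
  exact hz (by rw [hzv, hv0, hcon.1, zero_add])

theorem skewKernel_mode {d : ℕ} {Ωm : Matrix (Fin d) (Fin d) ℝ} (hΩ : Ωm.PosDef)
    (ν : ℝ) {α : Fin d → ℝ} (hα : α ≠ 0) {A : ℝ} (y0 : ℝ)
    (hA : A = Real.sqrt (α ⬝ᵥ (corrMat Ωm *ᵥ α))) :
    skewKernel Ωm α ν ((y0 / A) • (Ωm *ᵥ ((scaleMat Ωm)⁻¹ *ᵥ α))) =
      skewProfile (ν + d) ν A y0 := by
  have hp := dotProduct_corrMat_mulVec_pos hΩ hα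
  have hA0 : 0 < A := hA ▸ Real.sqrt_pos.2 hp
  have hA2 : A ^ 2 = α ⬝ᵥ (corrMat Ωm *ᵥ α) := hA ▸ Real.sq_sqrt hp.le
  rw [dotProduct_corrMat_mulVec] at hA2
  rw [skewKernel, dotProduct_inv_scaleMat_mulVec, skewProfile, skewArg]
  set b := (scaleMat Ωm)⁻¹ *ᵥ α
  have hQ := quadForm_inv_add_smul hΩ b 0 (y0 / A)
  rw [zero_add, zero_dotProduct, dotProduct_zero, ← hA2] at hQ
  have hQ' : 0 + 2 * (y0 / A) * 0 + (y0 / A) ^ 2 * A ^ 2 = y0 ^ 2 := by field_simp; ring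
  have hb : b ⬝ᵥ ((y0 / A) • (Ωm *ᵥ b)) = A * y0 := by
    rw [dotProduct_smul, ← hA2, smul_eq_mul]; field_simp
  rw [hQ, hQ', hb, add_comm ν (y0 ^ 2)]

theorem skewKernel_zero_lt {d : ℕ} {Ωm : Matrix (Fin d) (Fin d) ℝ} (hΩ : Ωm.PosDef)
    {ν : ℝ} (hν : 0 < ν) {z : Fin d → ℝ} (hz : z ≠ 0) :
    skewKernel Ωm 0 ν z < skewKernel Ωm 0 ν 0 := by
  have hm : 0 < ν + d := by positivity
  have hQ : 0 < z ⬝ᵥ (Ωm⁻¹ *ᵥ z) := by simpa using hΩ.inv.dotProduct_mulVec_pos hz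
  have hT := T1CDF_pos hm 0
  simp only [skewKernel, zero_dotProduct, zero_mul]
  refine mul_lt_mul_of_pos_right ?_ hT
  refine Real.rpow_lt_rpow_of_neg (by positivity) ?_ (by linarith)
  gcongr

theorem div_deltaStar_smul_deltaOf {d : ℕ} {R : Matrix (Fin d) (Fin d) ℝ}
    (hR : IsUnit R.det) {α : Fin d → ℝ} (hα : 0 < α ⬝ᵥ (R *ᵥ α)) (y : ℝ) :
    (y / Real.sqrt (deltaOf R α ⬝ᵥ (R⁻¹ *ᵥ deltaOf R α))) • deltaOf R α =
      (y / Real.sqrt (α ⬝ᵥ (R *ᵥ α))) • (R *ᵥ α) := by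
  have e : R⁻¹ *ᵥ (R *ᵥ α) = α := by rw [mulVec_mulVec, nonsing_inv_mul _ hR, one_mulVec]
  simp only [deltaOf, mulVec_smul, e, smul_dotProduct, dotProduct_smul, smul_eq_mul,
    dotProduct_comm (R *ᵥ α) α, smul_smul]
  set p := α ⬝ᵥ (R *ᵥ α)
  have hs : 0 < Real.sqrt (1 + p) := Real.sqrt_pos.2 (by positivity)
  have hq := Real.sqrt_pos.2 hα
  rw [← mul_assoc, Real.sqrt_mul (by positivity), Real.sqrt_mul_self (by positivity)]
  congr 1
  field_simp

/-- the multivariate skew `t` density has a unique mode, lying at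
`ξ + (y₀*/α*) ω Ω̄ α = ξ + (y₀*/δ*) ω δ`, where `y₀* ≥ 0` is the unique solution of
`y(ν+d)^{1/2} T₁(w(y); ν+d) − t₁(w(y); ν+d) ν α* (ν+y²)^{−1/2} = 0`. -/
theorem skew_t_unique_mode
    {d : ℕ} (ξ α : Fin d → ℝ) (Ωm : Matrix (Fin d) (Fin d) ℝ) (hΩ : Ωm.PosDef)
    (ν : ℝ) (hν : 0 < ν) :
    let αstar := Real.sqrt (α ⬝ᵥ (corrMat Ωm *ᵥ α))
    let δ := deltaOf (corrMat Ωm) α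
    let δstar := Real.sqrt (δ ⬝ᵥ ((corrMat Ωm)⁻¹ *ᵥ δ))
    let w := fun y : ℝ => αstar * y * Real.sqrt ((ν + d) / (ν + y ^ 2))
    let g := fun y : ℝ => y * Real.sqrt (ν + d) * T1CDF (ν + d) (w y) -
      t1PDF (ν + d) (w y) * ν * αstar * (Real.sqrt (ν + y ^ 2))⁻¹
    ∃ y0 : ℝ,
      -- y₀* is the unique real solution of the equation, and y₀* ≥ 0
      g y0 = 0 ∧ (∀ y : ℝ, g y = 0 → y = y0) ∧ 0 ≤ y0 ∧
      ∃ M0 : Fin d → ℝ,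
        -- M0 is the unique mode of the skew t density
        (∀ z : Fin d → ℝ, z ≠ M0 → stPDF ξ Ωm α ν z < stPDF ξ Ωm α ν M0) ∧
        -- when α = 0 the mode is ξ
        (α = 0 → M0 = ξ) ∧
        -- when α ≠ 0 the mode is ξ + (y₀*/α*) ω Ω̄ α = ξ + (y₀*/δ*) ω δ
        (α ≠ 0 →
          M0 = ξ + (y0 / αstar) • (scaleMat Ωm *ᵥ (corrMat Ωm *ᵥ α)) ∧
          M0 = ξ + (y0 / δstar) • (scaleMat Ωm *ᵥ δ)) := by
  intro αstar δ δstar w g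
  have hm : 0 < ν + d := by positivity
  rcases eq_or_ne α 0 with rfl | hα
  · have hg : ∀ y, g y = y * (Real.sqrt (ν + d) * T1CDF (ν + d) 0) := fun y => by
      simp [g, w, αstar, mul_assoc]
    have hc : Real.sqrt (ν + d) * T1CDF (ν + d) 0 ≠ 0 :=
      (mul_pos (Real.sqrt_pos.2 hm) (T1CDF_pos hm 0)).ne'
    refine ⟨0, by simp [hg], fun y hy => ?_, le_rfl, ξ, fun z hz => ?_, fun _ => rfl,
      fun h => absurd rfl h⟩
    · rw [hg] at hy
      exact (mul_eq_zero.1 hy).resolve_right hc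
    · refine stPDF_lt_of_skewKernel_lt hΩ hν ξ 0 ?_
      rw [sub_self]
      exact skewKernel_zero_lt hΩ hν (sub_ne_zero.2 hz)
  · have hp := dotProduct_corrMat_mulVec_pos hΩ hα
    have hA : 0 < αstar := Real.sqrt_pos.2 hp
    obtain ⟨y0, hy0, h0⟩ := exists_modeEq_eq_zero hm hν hA
    refine ⟨y0, h0, fun y hy => ?_, hy0.le,
      ξ + (y0 / αstar) • (scaleMat Ωm *ᵥ (corrMat Ωm *ᵥ α)), fun z hz => ?_,
      fun h => absurd h hα, fun _ => ⟨rfl, ?_⟩⟩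
    · rcases lt_trichotomy y y0 with h | h | h
      · exact absurd hy (modeEq_neg_of_lt hm hν hA hy0 h0 h).ne
      · exact h
      · exact absurd hy (modeEq_pos_of_gt hm hν hA hy0 h0 h).ne'
    · rw [scaleMat_mulVec_corrMat hΩ] at hz ⊢
      refine stPDF_lt_of_skewKernel_lt hΩ hν ξ α ?_
      rw [add_sub_cancel_left, skewKernel_mode hΩ ν hα y0 rfl]
      refine skewKernel_lt_skewProfile hΩ hν hα rfl hy0 h0 fun h => hz ?_
      rw [← h, add_sub_cancel]
    · rw [← mulVec_smul, ← mulVec_smul (scaleMat Ωm) _ δ]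
      exact congrArg (fun x => ξ + scaleMat Ωm *ᵥ x)
        (div_deltaStar_smul_deltaOf (isUnit_det_corrMat hΩ) hp y0).symm

end
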